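/- For all natural numbers m, n and every complex number d with Re(d) > 0, there holds ₃F₂(1/2 + m, 1/2 − m, d+1; m + 2n + 5/2, d; 1/2) = (π / 2^(m + 2n + 5/2)) (3/2)_{m+2n+1} · [ (2/d) / ((m+n)! n!) + (1 − (3/2 + m + 2n)/d) / (π (1/2)_{m+n+1} (1/2)_{n+1}) ]. -/

import Mathlib

open scoped Nat

/-- Pochhammer symbol `(x)_k = x (x+1) ⋯ (x+k-1)` for a complex number `x`. -/
noncomputable def poch (x : ℂ) (k : ℕ) : ℂ := (ascPochhammer ℂ k).eval x

/-- The generalized hypergeometric series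
`ₚF_q(a₁,…,aₚ; b₁,…,b_q; z) = ∑ₖ ((a₁)ₖ ⋯ (aₚ)ₖ)/((b₁)ₖ ⋯ (b_q)ₖ) · zᵏ/k!`. -/
noncomputable def hyp (a b : List ℂ) (z : ℂ) : ℂ :=
  ∑' k : ℕ, ((a.map (poch · k)).prod / (b.map (poch · k)).prod) * z ^ k / (k ! : ℂ)

open Filter Topology

lemma poch_zero (x : ℂ) : poch x 0 = 1 := by simp [poch]

lemma poch_succ (x : ℂ) (k : ℕ) : poch x (k + 1) = poch x k * (x + k) :=
  ascPochhammer_succ_eval k x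

lemma poch_succ_left (x : ℂ) (k : ℕ) : poch x (k + 1) = x * poch (x + 1) k := by
  simp [poch, ascPochhammer_succ_left]

lemma poch_ne_zero {x : ℂ} (hx : ∀ k : ℕ, x + k ≠ 0) (k : ℕ) : poch x k ≠ 0 := by
  induction k with
  | zero => simp [poch_zero]
  | succ k ih => rw [poch_succ]; exact mul_ne_zero ih (hx k)

lemma add_natCast_ne_zero_of_re_pos {x : ℂ} (hx : 0 < x.re) (k : ℕ) : x + k ≠ 0 := by
  intro h
  have := congrArg Complex.re h
  simp only [Complex.add_re, Complex.natCast_re, Complex.zero_re] at this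
  have : (0 : ℝ) ≤ k := k.cast_nonneg
  linarith

lemma add_one_add_natCast_ne_zero {x : ℂ} (hx : ∀ k : ℕ, x + k ≠ 0) (k : ℕ) : x + 1 + k ≠ 0 := by
  simpa [add_assoc, add_comm (1 : ℂ)] using hx (k + 1)

lemma re_pos_of_eq_ofReal {z : ℂ} {x : ℝ} (h : z = x) (hx : 0 < x) : 0 < z.re := by
  rwa [h, Complex.ofReal_re]

lemma ofReal_sqrt_two_sq : ((√2 : ℝ) : ℂ) ^ 2 = 2 := by
  rw [← Complex.ofReal_pow, Real.sq_sqrt zero_le_two]; norm_num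

/-- The terms of the series `₂F₁(a, 1 - a; c; 1/2)`. -/
noncomputable def baileyTerm (a c : ℂ) (k : ℕ) : ℂ :=
  poch a k * poch (1 - a) k / poch c k * (1 / 2) ^ k / (k ! : ℂ)

/-- The value `₂F₁(a, 1 - a; c; 1/2)`. -/
noncomputable def baileySum (a c : ℂ) : ℂ := ∑' k, baileyTerm a c k

lemma baileyTerm_one_sub (a c : ℂ) (k : ℕ) : baileyTerm (1 - a) c k = baileyTerm a c k := by
  simp only [baileyTerm, sub_sub_cancel, mul_comm (poch a k)]

lemma baileySum_one_sub (a c : ℂ) : baileySum (1 - a) c = baileySum a c :=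
  tsum_congr (baileyTerm_one_sub a c)

lemma baileyTerm_succ (a : ℂ) {c : ℂ} (k : ℕ) :
    baileyTerm a c (k + 1) =
      (a + k) / (c + k) * ((1 - a + k) / (1 + k)) * (1 / 2) * baileyTerm a c k := by
  simp only [baileyTerm, poch_succ, Nat.factorial_succ, Nat.cast_mul, Nat.cast_succ, pow_succ,
    div_eq_mul_inv, mul_inv, add_comm (k : ℂ) 1]
  ring

lemma tendsto_add_natCast_div (a c : ℂ) :
    Tendsto (fun k : ℕ ↦ (a + k) / (c + k)) atTop (𝓝 1) := by
  simpa using tendsto_add_mul_div_add_mul_atTop_nhds a c (1 : ℂ) (one_ne_zero (α := ℂ))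

lemma summable_baileyTerm (a c : ℂ) : Summable (baileyTerm a c) := by
  have h : Tendsto (fun k : ℕ ↦ ‖(a + k) / (c + k) * ((1 - a + k) / (1 + k)) * (1 / 2)‖) atTop
      (𝓝 (1 / 2)) := by
    have := (((tendsto_add_natCast_div a c).mul
      (tendsto_add_natCast_div (1 - a) 1)).mul_const (1 / 2)).norm
    rwa [show ‖(1 * 1 * (1 / 2) : ℂ)‖ = 1 / 2 by norm_num] at this
  refine summable_of_ratio_norm_eventually_le (r := 3 / 4) (by norm_num) ?_
  filter_upwards [h.eventually_le_const (by norm_num : (1 / 2 : ℝ) < 3 / 4)] with k hk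
  rw [baileyTerm_succ, norm_mul]
  gcongr

lemma sum_range_baileyTerm (a : ℂ) {c : ℂ} (hc : ∀ k : ℕ, c + k ≠ 0) (N : ℕ) :
    ∑ k ∈ Finset.range (N + 1), ((c + a) * baileyTerm (a + 1) (c + 1) k - c * baileyTerm a c k) =
      c * ((a + N) / (c + N)) * baileyTerm a c N := by
  have hc0 : c ≠ 0 := by simpa using hc 0
  induction N with
  | zero => simp [baileyTerm, poch_zero]; field_simp
  | succ N ih =>
    rw [Finset.sum_range_succ, ih]
    have h1 := add_one_add_natCast_ne_zero hc N
    have hN : (N : ℂ) + 1 ≠ 0 := by exact_mod_cast N.succ_ne_zero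
    have hf : (N ! : ℂ) ≠ 0 := by exact_mod_cast N.factorial_ne_zero
    have hZ : poch c N * (c + N) = c * poch (c + 1) N := by rw [← poch_succ, poch_succ_left]
    have hX : poch a N * (a + N) = a * poch (a + 1) N := by rw [← poch_succ, poch_succ_left]
    have hc1 := add_one_add_natCast_ne_zero hc
    have hZ0 := poch_ne_zero hc1 N
    have hprev : c * ((a + N) / (c + N)) * baileyTerm a c N =
        a * poch (a + 1) N * poch (1 - a) N / poch (c + 1) N * (1 / 2) ^ N / (N ! : ℂ) := by
      rw [← hX]
      simp only [baileyTerm]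
      have := poch_ne_zero hc N
      have := hc N
      field_simp
      linear_combination (-(a + N)) * poch a N * poch (1 - a) N * hZ
    have hterm : baileyTerm a c (N + 1) = a * poch (a + 1) N * (poch (1 - a) N * (1 - a + N)) /
        (c * poch (c + 1) N) * (1 / 2) ^ (N + 1) / ((N + 1) * N ! : ℂ) := by
      rw [baileyTerm, poch_succ_left a, poch_succ (1 - a), poch_succ_left c, Nat.factorial_succ]
      push_cast; rfl
    have hterm' : baileyTerm (a + 1) (c + 1) (N + 1) =
        poch (a + 1) N * (a + 1 + N) * (-a * poch (1 - a) N) /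
        (poch (c + 1) N * (c + 1 + N)) * (1 / 2) ^ (N + 1) / ((N + 1) * N ! : ℂ) := by
      rw [baileyTerm, poch_succ (a + 1), show 1 - (a + 1) = -a by ring, poch_succ_left (-a),
        show -a + 1 = 1 - a by ring, poch_succ (c + 1), Nat.factorial_succ]
      push_cast; rfl
    rw [hprev, hterm, hterm', pow_succ, Nat.cast_succ,
      show c + ((N : ℂ) + 1) = c + 1 + N by ring]
    field_simp
    ring

lemma baileySum_add_one (a : ℂ) {c : ℂ} (hc : ∀ k : ℕ, c + k ≠ 0) :
    (c + a) * baileySum (a + 1) (c + 1) = c * baileySum a c := by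
  have hs := ((summable_baileyTerm (a + 1) (c + 1)).hasSum.mul_left (c + a)).sub
    ((summable_baileyTerm a c).hasSum.mul_left c)
  have h1 := (tendsto_add_atTop_iff_nat 1).2 hs.tendsto_sum_nat
  have h2 := ((tendsto_add_natCast_div a c).const_mul c).mul
    (summable_baileyTerm a c).tendsto_atTop_zero
  simp only [sum_range_baileyTerm a hc] at h1
  have := tendsto_nhds_unique h1 h2
  simp only [mul_zero] at this
  exact sub_eq_zero.1 this

lemma baileySum_add_two (a : ℂ) {c : ℂ} (hc : ∀ k : ℕ, c + k ≠ 0) :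
    (c + a) * (c + 1 - a) * baileySum a (c + 2) = c * (c + 1) * baileySum a c := by
  have hc1 := add_one_add_natCast_ne_zero hc
  have h1 := baileySum_add_one (a - 1) hc1
  have h2 := baileySum_add_one (1 - a) hc
  rw [baileySum_one_sub, ← baileySum_one_sub,
    show 1 - (1 - a + 1) = a - 1 by ring] at h2
  rw [sub_add_cancel, show c + 1 + 1 = c + 2 by ring] at h1
  linear_combination (c + 1 - a) * h1 + (c + 1) * h2

lemma natCast_mul_baileyTerm_add_one (a : ℂ) {c : ℂ} (hc : ∀ k : ℕ, c + k ≠ 0) (k : ℕ) :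
    k * baileyTerm a (c + 1) k = c * (baileyTerm a c k - baileyTerm a (c + 1) k) := by
  have hc1 := add_one_add_natCast_ne_zero hc
  have hZ : poch c k * (c + k) = c * poch (c + 1) k := by rw [← poch_succ, poch_succ_left]
  have := poch_ne_zero hc k
  have := poch_ne_zero hc1 k
  have hf : (k ! : ℂ) ≠ 0 := by exact_mod_cast k.factorial_ne_zero
  simp only [baileyTerm]
  field_simp
  linear_combination poch a k * poch (1 - a) k * hZ

lemma choose_half_eq (k : ℕ) :
    (k ! : ℝ) * Ring.choose (1 / 2 + k - 1 : ℝ) k = (ascPochhammer ℝ k).eval (1 / 2) := by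
  rw [Ring.choose, show (1 / 2 + k - 1 - k + 1 : ℝ) = 1 / 2 by ring, ← nsmul_eq_mul,
    Ring.factorial_nsmul_multichoose_eq_ascPochhammer, Polynomial.ascPochhammer_smeval_eq_eval]

lemma hasSum_binomial_half {x : ℝ} (hx : |x| < 1) :
    HasSum (fun k : ℕ ↦ (ascPochhammer ℝ k).eval (1 / 2) / k ! * x ^ k) (1 / √(1 - x)) := by
  have h := (Real.one_div_one_sub_rpow_hasFPowerSeriesOnBall_zero (1 / 2)).hasSum (y := x)
    (by simpa [enorm_eq_nnnorm, ← NNReal.coe_lt_coe] using hx)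
  simp only [zero_add, ← Real.sqrt_eq_rpow] at h
  refine h.congr_fun fun k ↦ ?_
  rw [← choose_half_eq, mul_div_cancel_left₀ _ (by positivity)]
  simp [mul_comm]

lemma ofReal_ascPochhammer (x : ℝ) (k : ℕ) :
    (((ascPochhammer ℝ k).eval x : ℝ) : ℂ) = poch x k := by
  rw [poch, ← ascPochhammer_map Complex.ofRealHom, ← Complex.ofRealHom_eq_coe,
    ← Complex.ofRealHom_eq_coe, Polynomial.eval_map_apply]

lemma poch_half_ne_zero (k : ℕ) : poch (1 / 2) k ≠ 0 :=
  poch_ne_zero (add_natCast_ne_zero_of_re_pos (by norm_num)) k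

lemma baileySum_half_half : baileySum (1 / 2) (1 / 2) = ((√2 : ℝ) : ℂ) := by
  have h := Complex.hasSum_ofReal.2 (hasSum_binomial_half (x := 1 / 2) (by norm_num [abs_of_pos]))
  rw [show 1 / √(1 - 1 / 2 : ℝ) = √2 by rw [one_div, ← Real.sqrt_inv]; norm_num] at h
  rw [← h.tsum_eq, baileySum]
  refine tsum_congr fun k ↦ ?_
  have := poch_half_ne_zero k
  rw [baileyTerm]
  push_cast [ofReal_ascPochhammer]
  norm_num
  field_simp

lemma integral_one_div_sqrt_one_sub_sq {s : ℝ} (hs0 : 0 ≤ s) (hs : s < 1) :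
    ∫ t in (0 : ℝ)..s, 1 / √(1 - t ^ 2) = Real.arcsin s := by
  rw [intervalIntegral.integral_eq_sub_of_hasDerivAt (f := Real.arcsin)]
  · simp
  · intro t ht
    rw [Set.uIcc_of_le hs0] at ht
    exact Real.hasDerivAt_arcsin (by linarith [ht.1]) (by linarith [ht.2])
  · refine ContinuousOn.intervalIntegrable fun t ht ↦ ?_
    rw [Set.uIcc_of_le hs0] at ht
    have : √(1 - t ^ 2) ≠ 0 := (Real.sqrt_pos.2 (by nlinarith [ht.1, ht.2])).ne'
    exact ContinuousAt.continuousWithinAt (by fun_prop (disch := assumption))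

lemma hasSum_arcsin {s : ℝ} (hs0 : 0 ≤ s) (hs : s < 1) :
    HasSum (fun k : ℕ ↦ (ascPochhammer ℝ k).eval (1 / 2) / k ! * (s ^ (2 * k + 1) / (2 * k + 1)))
      (Real.arcsin s) := by
  have hpos : ∀ k : ℕ, 0 ≤ (ascPochhammer ℝ k).eval (1 / 2) / k ! := fun k ↦
    div_nonneg (ascPochhammer_pos k _ (by norm_num)).le (by positivity)
  have hlt : ∀ t : ℝ, 0 ≤ t → t ≤ s → |t ^ 2| < 1 := fun t h0 h1 ↦ by
    rw [abs_of_nonneg (sq_nonneg t)]; nlinarith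
  have h := intervalIntegral.hasSum_integral_of_dominated_convergence (a := 0) (b := s)
    (μ := MeasureTheory.volume)
    (F := fun (k : ℕ) (t : ℝ) ↦ (ascPochhammer ℝ k).eval (1 / 2) / k ! * (t ^ 2) ^ k)
    (f := fun t ↦ 1 / √(1 - t ^ 2))
    (fun (k : ℕ) _ ↦ (ascPochhammer ℝ k).eval (1 / 2) / k ! * (s ^ 2) ^ k)
    (fun k ↦ (by fun_prop : Continuous _).aestronglyMeasurable)
    (fun k ↦ .of_forall fun t ht ↦ by
      rw [Set.uIoc_of_le hs0] at ht
      have := ht.1.le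
      have := ht.2
      rw [Real.norm_of_nonneg (mul_nonneg (hpos k) (by positivity))]
      have := hpos k
      gcongr)
    (.of_forall fun t _ ↦ (hasSum_binomial_half (hlt s hs0 le_rfl)).summable)
    intervalIntegrable_const
    (.of_forall fun t ht ↦ by
      rw [Set.uIoc_of_le hs0] at ht
      exact hasSum_binomial_half (hlt t ht.1.le ht.2))
  rw [integral_one_div_sqrt_one_sub_sq hs0 hs] at h
  refine h.congr_fun fun k ↦ ?_
  simp [← pow_mul]

lemma poch_three_halves (k : ℕ) : poch (3 / 2) k = (2 * k + 1) * poch (1 / 2) k := by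
  have h := poch_succ_left (1 / 2) k
  rw [poch_succ, show (1 / 2 + 1 : ℂ) = 3 / 2 by norm_num] at h
  linear_combination -2 * h

lemma baileySum_half_three_halves :
    baileySum (1 / 2) (3 / 2) = ((√2 : ℝ) : ℂ) * Real.pi / 4 := by
  have hs : √2 / 2 < 1 := by
    nlinarith [Real.sq_sqrt (zero_le_two (α := ℝ)), Real.sqrt_nonneg 2]
  have h := (Complex.hasSum_ofReal.2 (hasSum_arcsin (by positivity) hs)).mul_left ((√2 : ℝ) : ℂ)
  have harc : Real.arcsin (√2 / 2) = Real.pi / 4 := by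
    rw [← Real.sin_pi_div_four]
    exact Real.arcsin_sin (by linarith [Real.pi_pos]) (by linarith [Real.pi_pos])
  rw [harc] at h
  have h2 := h.tsum_eq
  push_cast at h2
  rw [mul_div_assoc, ← h2, baileySum]
  refine tsum_congr fun k ↦ ?_
  have := poch_half_ne_zero k
  have hk : (2 * k + 1 : ℂ) ≠ 0 := by exact_mod_cast (2 * k).succ_ne_zero
  have hf : (k ! : ℂ) ≠ 0 := by exact_mod_cast k.factorial_ne_zero
  have hhalf : (1 - 1 / 2 : ℂ) = 1 / 2 := by norm_num
  have hquot : (((√2 : ℝ) : ℂ) / 2) ^ 2 = 1 / 2 := by rw [div_pow, ofReal_sqrt_two_sq]; norm_num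
  rw [baileyTerm, poch_three_halves, ofReal_ascPochhammer, pow_succ, pow_mul, hquot, hhalf]
  push_cast
  field_simp
  linear_combination -ofReal_sqrt_two_sq

lemma baileySum_half_odd (n : ℕ) :
    baileySum (1 / 2) (2 * n + 3 / 2) * (2 ^ (2 * n + 1) * ((√2 : ℝ) : ℂ)) * (n ! * n !) =
      Real.pi * poch (3 / 2) (2 * n) := by
  induction n with
  | zero =>
    simp only [Nat.cast_zero, mul_zero, zero_add, baileySum_half_three_halves, poch_zero,
      Nat.factorial_zero, Nat.cast_one]
    linear_combination Real.pi / 2 * ofReal_sqrt_two_sq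
  | succ n ih =>
    have hc : 0 < (2 * n + 3 / 2 : ℂ).re :=
      re_pos_of_eq_ofReal (x := 2 * n + 3 / 2) (by push_cast; ring) (by positivity)
    have h := baileySum_add_two (1 / 2) (add_natCast_ne_zero_of_re_pos hc)
    rw [show 2 * ((n + 1 : ℕ) : ℂ) + 3 / 2 = 2 * n + 3 / 2 + 2 by push_cast; ring,
      show 2 * (n + 1) = 2 * n + 1 + 1 by ring, poch_succ, poch_succ, Nat.factorial_succ]
    push_cast
    linear_combination (3 / 2 + 2 * n) * (3 / 2 + (2 * n + 1)) * ih +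
      2 ^ (2 * n + 1) * ((√2 : ℝ) : ℂ) * (n ! * n !) * h

lemma baileySum_odd (m n : ℕ) :
    baileySum (1 / 2 + m) (m + 2 * n + 3 / 2) * (2 ^ (m + 2 * n + 1) * ((√2 : ℝ) : ℂ)) *
      ((m + n)! * n !) = Real.pi * poch (3 / 2) (m + 2 * n) := by
  induction m with
  | zero => simpa using baileySum_half_odd n
  | succ m ih =>
    have hc : 0 < (m + 2 * n + 3 / 2 : ℂ).re :=
      re_pos_of_eq_ofReal (x := m + 2 * n + 3 / 2) (by push_cast; ring) (by positivity)
    have h := baileySum_add_one (1 / 2 + m) (add_natCast_ne_zero_of_re_pos hc)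
    rw [show ((m + 1 : ℕ) : ℂ) + 2 * n + 3 / 2 = m + 2 * n + 3 / 2 + 1 by push_cast; ring,
      show 1 / 2 + ((m + 1 : ℕ) : ℂ) = 1 / 2 + m + 1 by push_cast; ring,
      show m + 1 + 2 * n = m + 2 * n + 1 by ring, show m + 1 + n = m + n + 1 by ring,
      poch_succ, Nat.factorial_succ]
    push_cast
    linear_combination (3 / 2 + (m + 2 * n)) * ih +
      2 ^ (m + 2 * n + 1) * ((√2 : ℝ) : ℂ) * ((m + n)! * n !) * h

lemma baileySum_half_even (n : ℕ) :
    baileySum (1 / 2) (2 * n + 5 / 2) * (2 ^ (2 * n + 2) * ((√2 : ℝ) : ℂ)) *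
      (poch (1 / 2) (n + 1) * poch (1 / 2) (n + 1)) = poch (3 / 2) (2 * n + 1) := by
  induction n with
  | zero =>
    have h := baileySum_add_two (1 / 2) (c := 1 / 2)
      (add_natCast_ne_zero_of_re_pos (re_pos_of_eq_ofReal (x := 1 / 2) (by simp) (by norm_num)))
    rw [baileySum_half_half, show (1 / 2 + 2 : ℂ) = 5 / 2 by norm_num] at h
    simp only [Nat.cast_zero, mul_zero, zero_add, poch_succ, poch_zero]
    linear_combination ((√2 : ℝ) : ℂ) * h + 3 / 4 * ofReal_sqrt_two_sq
  | succ n ih =>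
    have hc : 0 < (2 * n + 5 / 2 : ℂ).re :=
      re_pos_of_eq_ofReal (x := 2 * n + 5 / 2) (by push_cast; ring) (by positivity)
    have h := baileySum_add_two (1 / 2) (add_natCast_ne_zero_of_re_pos hc)
    rw [show 2 * ((n + 1 : ℕ) : ℂ) + 5 / 2 = 2 * n + 5 / 2 + 2 by push_cast; ring,
      show 2 * (n + 1) + 1 = 2 * n + 1 + 1 + 1 by ring, poch_succ _ (2 * n + 1 + 1),
      poch_succ _ (2 * n + 1), poch_succ _ (n + 1)]
    push_cast
    linear_combination (3 / 2 + (2 * n + 1)) * (3 / 2 + (2 * n + 1 + 1)) * ih +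
      2 ^ (2 * n + 2) * ((√2 : ℝ) : ℂ) * (poch (1 / 2) (n + 1) * poch (1 / 2) (n + 1)) * h

lemma baileySum_even (m n : ℕ) :
    baileySum (1 / 2 + m) (m + 2 * n + 5 / 2) * (2 ^ (m + 2 * n + 2) * ((√2 : ℝ) : ℂ)) *
      (poch (1 / 2) (m + n + 1) * poch (1 / 2) (n + 1)) = poch (3 / 2) (m + 2 * n + 1) := by
  induction m with
  | zero => simpa using baileySum_half_even n
  | succ m ih =>
    have hc : 0 < (m + 2 * n + 5 / 2 : ℂ).re :=
      re_pos_of_eq_ofReal (x := m + 2 * n + 5 / 2) (by push_cast; ring) (by positivity)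
    have h := baileySum_add_one (1 / 2 + m) (add_natCast_ne_zero_of_re_pos hc)
    rw [show ((m + 1 : ℕ) : ℂ) + 2 * n + 5 / 2 = m + 2 * n + 5 / 2 + 1 by push_cast; ring,
      show 1 / 2 + ((m + 1 : ℕ) : ℂ) = 1 / 2 + m + 1 by push_cast; ring,
      show m + 1 + 2 * n = m + 2 * n + 1 by ring, show m + 1 + n = m + n + 1 by ring,
      poch_succ _ (m + 2 * n + 1), poch_succ _ (m + n + 1)]
    push_cast
    linear_combination (3 / 2 + (m + 2 * n + 1)) * ih +
      2 ^ (m + 2 * n + 2) * ((√2 : ℝ) : ℂ) *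
        (poch (1 / 2) (m + n + 1) * poch (1 / 2) (n + 1)) * h

lemma hyp_eq_baileySum (a : ℂ) {c d : ℂ} (hc : ∀ k : ℕ, c + k ≠ 0) (hd : ∀ k : ℕ, d + k ≠ 0) :
    hyp [a, 1 - a, d + 1] [c + 1, d] (1 / 2) =
      baileySum a (c + 1) + c / d * (baileySum a c - baileySum a (c + 1)) := by
  have h0 : HasSum (baileyTerm a c) (baileySum a c) := (summable_baileyTerm a c).hasSum
  have h1 : HasSum (baileyTerm a (c + 1)) (baileySum a (c + 1)) :=
    (summable_baileyTerm a (c + 1)).hasSum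
  refine ((h1.add ((h0.sub h1).mul_left (c / d))).congr_fun fun k ↦ ?_).tsum_eq
  have hd0 : d ≠ 0 := by simpa using hd 0
  have hdk := poch_ne_zero hd k
  have hr : poch (d + 1) k / poch d k = 1 + k / d := by
    have h : poch d k * (d + k) = d * poch (d + 1) k := by rw [← poch_succ, poch_succ_left]
    field_simp
    linear_combination -h
  have hterm : ([a, 1 - a, d + 1].map (poch · k)).prod / ([c + 1, d].map (poch · k)).prod *
      (1 / 2) ^ k / (k ! : ℂ) = poch (d + 1) k / poch d k * baileyTerm a (c + 1) k := by
    simp only [List.map_cons, List.map_nil, List.prod_cons, List.prod_nil, mul_one, baileyTerm,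
      div_eq_mul_inv, mul_inv]
    ring
  rw [hterm, hr]
  linear_combination (1 / d) * natCast_mul_baileyTerm_add_one a hc k

theorem extended_bailey_formula (m n : ℕ) (d : ℂ) (hd : 0 < d.re) :
    hyp [1/2 + (m : ℂ), 1/2 - (m : ℂ), d + 1] [(m : ℂ) + 2 * (n : ℂ) + 5/2, d] (1/2) =
      (Real.pi : ℂ) / (2 : ℂ) ^ ((m : ℂ) + 2 * (n : ℂ) + 5/2) *
        poch (3/2) (m + 2 * n + 1) *
        ((2 / d) / (((m + n)! : ℂ) * (n ! : ℂ)) +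
          (1 - (3/2 + (m : ℂ) + 2 * (n : ℂ)) / d) /
            ((Real.pi : ℂ) * poch (1/2) (m + n + 1) * poch (1/2) (n + 1))) := by
  have hc : 0 < (m + 2 * n + 3 / 2 : ℂ).re :=
    re_pos_of_eq_ofReal (x := m + 2 * n + 3 / 2) (by push_cast; ring) (by positivity)
  have hd0 : d ≠ 0 := by simpa using add_natCast_ne_zero_of_re_pos hd 0
  have h := hyp_eq_baileySum (1 / 2 + m) (add_natCast_ne_zero_of_re_pos hc)
    (add_natCast_ne_zero_of_re_pos hd)
  rw [show (1 - (1 / 2 + m) : ℂ) = 1 / 2 - m by ring,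
    show (m + 2 * n + 3 / 2 + 1 : ℂ) = m + 2 * n + 5 / 2 by ring] at h
  have hw : ((√2 : ℝ) : ℂ) ≠ 0 := fun h0 ↦ by simpa [h0] using ofReal_sqrt_two_sq
  have hpow : (2 : ℂ) ^ ((m : ℂ) + 2 * (n : ℂ) + 5 / 2) =
      2 ^ (m + 2 * n + 2) * ((√2 : ℝ) : ℂ) := by
    rw [show (m : ℂ) + 2 * n + 5 / 2 = ((m + 2 * n + 2 : ℕ) : ℂ) + ((1 / 2 : ℝ) : ℂ) by
      push_cast; ring, Complex.cpow_add _ _ two_ne_zero, Complex.cpow_natCast, Real.sqrt_eq_rpow,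
      Complex.ofReal_cpow zero_le_two, Complex.ofReal_ofNat]
  have hpi : (Real.pi : ℂ) ≠ 0 := by exact_mod_cast Real.pi_ne_zero
  have hf : ∀ k : ℕ, (k ! : ℂ) ≠ 0 := fun k ↦ by exact_mod_cast k.factorial_ne_zero
  have h2 : (2 : ℂ) ^ (m + 2 * n + 1) ≠ 0 := pow_ne_zero _ two_ne_zero
  have hodd : baileySum (1 / 2 + m) (m + 2 * n + 3 / 2) =
      Real.pi * poch (3 / 2) (m + 2 * n) /
        (2 ^ (m + 2 * n + 1) * ((√2 : ℝ) : ℂ) * ((m + n)! * n !)) := by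
    rw [← baileySum_odd, mul_assoc, mul_div_cancel_right₀]
    exact mul_ne_zero (mul_ne_zero h2 hw) (mul_ne_zero (hf _) (hf _))
  have heven : baileySum (1 / 2 + m) (m + 2 * n + 5 / 2) = poch (3 / 2) (m + 2 * n + 1) /
      (2 ^ (m + 2 * n + 2) * ((√2 : ℝ) : ℂ) *
        (poch (1 / 2) (m + n + 1) * poch (1 / 2) (n + 1))) := by
    rw [← baileySum_even, mul_assoc, mul_div_cancel_right₀]
    exact mul_ne_zero (mul_ne_zero (pow_ne_zero _ two_ne_zero) hw)
      (mul_ne_zero (poch_half_ne_zero _) (poch_half_ne_zero _))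
  have hp1 := poch_half_ne_zero (m + n + 1)
  have hp2 := poch_half_ne_zero (n + 1)
  have hf1 := hf (m + n)
  have hf2 := hf n
  rw [h, hpow, hodd, heven, poch_succ _ (m + 2 * n), pow_succ _ (m + 2 * n + 1)]
  push_cast
  field_simp
  ring
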